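/- arXiv:1007.4372 — 8 statements merged into one kernel-verified Lean document; each statement's English description precedes it below -/
import Mathlib

section
/- In the single-step multinomial game (N = 1), the upper hedging price of any payoff function f : X → ℝ equals the maximum, taken over all negative elements a⁻ of X and all nonnegative elements a⁺ of X, of (a⁺·f(a⁻) − a⁻·f(a⁺))/(a⁺ − a⁻). -/
noncomputable def capitalAux (P : List ℝ → ℝ) : List ℝ → List ℝ → ℝ
  | _, [] => 0
  | pre, x :: rest => P pre * x + capitalAux P (pre ++ [x]) rest

/-- Upper hedging price of payoff `F` in the `N`-round multinomial game with move space `X`. -/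
noncomputable def upperPrice (X : Finset ℝ) (N : ℕ) (F : List ℝ → ℝ) : ℝ :=
  sInf {α : ℝ | ∃ P : List ℝ → ℝ,
    ∀ ξ : List ℝ, ξ.length = N → (∀ x ∈ ξ, x ∈ X) → F ξ ≤ α + capitalAux P [] ξ}

/-- Lower hedging price. -/
noncomputable def lowerPrice (X : Finset ℝ) (N : ℕ) (F : List ℝ → ℝ) : ℝ :=
  -upperPrice X N (fun ξ => -F ξ)

/-- A number `α` superhedges a one-step payoff iff some slope `p` satisfies `f x ≤ α + p * x`. -/
theorem upperPrice_one (X : Finset ℝ) (f : ℝ → ℝ) :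
    upperPrice X 1 (fun ξ => f ξ.headI) =
      sInf {α : ℝ | ∃ p : ℝ, ∀ x ∈ X, f x ≤ α + p * x} := by
  unfold upperPrice
  congr 1
  ext α
  constructor
  · rintro ⟨P, hP⟩
    refine ⟨P [], fun x hx => ?_⟩
    simpa [capitalAux] using hP [x] rfl (by simpa using hx)
  · rintro ⟨p, hp⟩
    refine ⟨fun _ => p, fun ξ hξ hX => ?_⟩
    obtain ⟨x, rfl⟩ := List.length_eq_one_iff.mp hξ
    simpa [capitalAux] using hp x (hX x (by simp))

/-- The two-point price is a lower bound for every superhedging capital. -/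
theorem two_point_price_le {f : ℝ → ℝ} {α p an ap : ℝ} (hn : an < 0) (hp : 0 ≤ ap)
    (h₁ : f an ≤ α + p * an) (h₂ : f ap ≤ α + p * ap) :
    (ap * f an - an * f ap) / (ap - an) ≤ α := by
  rw [div_le_iff₀ (by linarith)]
  linarith [mul_le_mul_of_nonneg_left h₁ hp, mul_le_mul_of_nonpos_left h₂ hn.le]

/-- A capital dominating all two-point prices admits a superhedging slope. -/
theorem exists_slope_of_two_point_price_le {X : Finset ℝ} (hneg : ∃ a ∈ X, a < 0)
    (hpos : ∃ a ∈ X, 0 < a) {f : ℝ → ℝ} {M : ℝ}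
    (hM : ∀ an ∈ X, ∀ ap ∈ X, an < 0 → 0 ≤ ap →
      (ap * f an - an * f ap) / (ap - an) ≤ M) :
    ∃ p : ℝ, ∀ x ∈ X, f x ≤ M + p * x := by
  obtain ⟨b, hbX, hb⟩ := hpos
  obtain ⟨c, hc, hmax⟩ := (X.filter (0 < ·)).exists_max_image (fun x => (f x - M) / x)
    ⟨b, by simp [hbX, hb]⟩
  obtain ⟨hcX, hc0⟩ := Finset.mem_filter.mp hc
  refine ⟨(f c - M) / c, fun x hx => ?_⟩
  rcases lt_trichotomy x 0 with h | rfl | h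
  · have key := hM x hx c hcX h hc0.le
    rw [div_le_iff₀ (by linarith)] at key
    have : f x - M ≤ (f c - M) * x / c := by
      rw [le_div_iff₀ hc0]
      linarith
    rw [div_mul_eq_mul_div]
    linarith
  · obtain ⟨a, haX, ha⟩ := hneg
    have key := hM a haX 0 hx ha le_rfl
    rw [div_le_iff₀ (by linarith)] at key
    nlinarith
  · have key := hmax x (by simp [hx, h])
    rw [div_le_iff₀ h] at key
    linarith

/-- In the single-step multinomial game, the upper hedging price of a payoff `f : X → ℝ`
is the maximum over negative elements `an` and nonnegative elements `ap` of `X` of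
`(ap * f an - an * f ap) / (ap - an)`. -/
theorem single_step_upper_price (X : Finset ℝ)
    (hneg : ∃ a ∈ X, a < 0) (hpos : ∃ a ∈ X, 0 < a) (f : ℝ → ℝ) :
    IsGreatest
      {v : ℝ | ∃ an ∈ X, ∃ ap ∈ X, an < 0 ∧ 0 ≤ ap ∧
        v = (ap * f an - an * f ap) / (ap - an)}
      (upperPrice X 1 (fun ξ => f ξ.headI)) := by
  rw [upperPrice_one]
  set V : Set ℝ := {v : ℝ | ∃ an ∈ X, ∃ ap ∈ X, an < 0 ∧ 0 ≤ ap ∧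
    v = (ap * f an - an * f ap) / (ap - an)}
  have hfin : V.Finite := by
    refine (Set.Finite.image2 (fun an ap => (ap * f an - an * f ap) / (ap - an))
      X.finite_toSet X.finite_toSet).subset ?_
    rintro v ⟨an, han, ap, hap, -, -, rfl⟩
    exact ⟨an, han, ap, hap, rfl⟩
  have hne : V.Nonempty := by
    obtain ⟨a, haX, ha⟩ := hneg
    obtain ⟨b, hbX, hb⟩ := hpos
    exact ⟨_, a, haX, b, hbX, ha, hb.le, rfl⟩
  obtain ⟨M, hMV, hM⟩ := Set.exists_max_image V id hfin hne
  have hleast : IsLeast {α : ℝ | ∃ p : ℝ, ∀ x ∈ X, f x ≤ α + p * x} M := by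
    constructor
    · exact exists_slope_of_two_point_price_le hneg hpos fun an han ap hap hn hp =>
        hM _ ⟨an, han, ap, hap, hn, hp, rfl⟩
    · rintro α ⟨p, hp⟩
      obtain ⟨an, han, ap, hap, hn, hp0, rfl⟩ := hMV
      exact two_point_price_le hn hp0 (hp an han) (hp ap hap)
  rw [hleast.csInf_eq]
  exact ⟨hMV, hM⟩
end

section
/- In the single-step multinomial game (N = 1), the lower hedging price of any payoff function f : X → ℝ equals the minimum, taken over all negative elements a⁻ of X and all nonnegative elements a⁺ of X, of (a⁺·f(a⁻) − a⁻·f(a⁺))/(a⁺ − a⁻). -/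
/-- The price `α` hedges `-f` in one round iff some affine function with intercept `-α`
lies below `f` on `X`. -/
theorem mem_superhedging_one_iff (X : Finset ℝ) (f : ℝ → ℝ) (α : ℝ) :
    (∃ P : List ℝ → ℝ, ∀ ξ : List ℝ, ξ.length = 1 → (∀ x ∈ ξ, x ∈ X) →
        -f ξ.headI ≤ α + capitalAux P [] ξ) ↔
      ∃ p : ℝ, ∀ x ∈ X, -α + p * x ≤ f x := by
  constructor
  · rintro ⟨P, hP⟩
    refine ⟨-P [], fun x hx => ?_⟩
    have h := hP [x] rfl (by simpa using hx)
    simp only [List.headI_cons, capitalAux] at h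
    linarith
  · rintro ⟨p, hp⟩
    refine ⟨fun _ => -p, fun ξ hlen hX => ?_⟩
    obtain ⟨x, rfl⟩ := List.length_eq_one_iff.mp hlen
    have h := hp x (hX x (by simp))
    simp only [List.headI_cons, capitalAux]
    linarith

/-- An affine function below `f` at a negative and a nonnegative point has intercept at most
that of the chord through these two points. -/
theorem intercept_le_chord {f : ℝ → ℝ} {c p a b : ℝ} (ha : a < 0) (hb : 0 ≤ b)
    (hfa : c + p * a ≤ f a) (hfb : c + p * b ≤ f b) :
    c ≤ (b * f a - a * f b) / (b - a) := by
  rw [le_div_iff₀ (by linarith)]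
  nlinarith [mul_le_mul_of_nonneg_left hfa hb,
    mul_le_mul_of_nonneg_left hfb (neg_nonneg.mpr ha.le)]

/-- If `m` is at most the intercept of every chord of `f` between a negative and a nonnegative
point of `X`, then some affine function with intercept `m` lies below `f` on `X`. -/
theorem exists_affine_le_of_le_chord (X : Finset ℝ) (hneg : ∃ a ∈ X, a < 0) (f : ℝ → ℝ) {m : ℝ}
    (hm : ∀ a ∈ X, ∀ b ∈ X, a < 0 → 0 ≤ b → m ≤ (b * f a - a * f b) / (b - a)) :
    ∃ p : ℝ, ∀ x ∈ X, m + p * x ≤ f x := by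
  obtain ⟨a₀, ha₀, ha₀'⟩ := hneg
  obtain ⟨a, ha, hmax⟩ := (X.filter (· < 0)).exists_max_image (fun a => (f a - m) / a)
    ⟨a₀, Finset.mem_filter.mpr ⟨ha₀, ha₀'⟩⟩
  obtain ⟨haX, ha⟩ := Finset.mem_filter.mp ha
  refine ⟨(f a - m) / a, fun x hx => ?_⟩
  rcases lt_or_ge x 0 with hx0 | hx0
  · have h := (div_le_iff_of_neg hx0).mp (hmax x (Finset.mem_filter.mpr ⟨hx, hx0⟩))
    linarith
  · have h := (le_div_iff₀ (by linarith)).mp (hm a haX x hx ha hx0)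
    have h' : (f a - m) / a * x ≤ f x - m := by
      rw [div_mul_eq_mul_div, div_le_iff_of_neg ha]
      linarith
    linarith

/-- In the single-step multinomial game, the lower hedging price of a payoff `f : X → ℝ`
is the minimum over negative elements `an` and nonnegative elements `ap` of `X` of
`(ap * f an - an * f ap) / (ap - an)`. -/
theorem single_step_lower_price (X : Finset ℝ)
    (hneg : ∃ a ∈ X, a < 0) (hpos : ∃ a ∈ X, 0 < a) (f : ℝ → ℝ) :
    IsLeast
      {v : ℝ | ∃ an ∈ X, ∃ ap ∈ X, an < 0 ∧ 0 ≤ ap ∧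
        v = (ap * f an - an * f ap) / (ap - an)}
      (lowerPrice X 1 (fun ξ => f ξ.headI)) := by
  obtain ⟨a₀, ha₀, ha₀'⟩ := hneg
  obtain ⟨b₀, hb₀, hb₀'⟩ := hpos
  obtain ⟨⟨a, b⟩, hab, hmin⟩ := ((X.filter (· < 0)) ×ˢ (X.filter (0 ≤ ·))).exists_min_image
    (fun q => (q.2 * f q.1 - q.1 * f q.2) / (q.2 - q.1))
    ⟨(a₀, b₀), by simp [ha₀, hb₀, ha₀', hb₀'.le]⟩
  simp only [Finset.mem_product, Finset.mem_filter, and_imp, Prod.forall] at hab hmin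
  obtain ⟨⟨haX, ha⟩, hbX, hb⟩ := hab
  have hprice : lowerPrice X 1 (fun ξ => f ξ.headI) = (b * f a - a * f b) / (b - a) := by
    rw [lowerPrice, upperPrice, neg_eq_iff_eq_neg]
    simp only [mem_superhedging_one_iff]
    refine IsLeast.csInf_eq ⟨?_, ?_⟩
    · simp only [Set.mem_ofPred_eq, neg_neg]
      exact exists_affine_le_of_le_chord X ⟨a₀, ha₀, ha₀'⟩ f
        fun c hc d hd hc' hd' => hmin c d hc hc' hd hd'
    · rintro α ⟨p, hp⟩
      exact neg_le.mp (intercept_le_chord ha hb (hp a haX) (hp b hbX))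
  rw [hprice]
  refine ⟨⟨a, haX, b, hbX, ha, hb, rfl⟩, ?_⟩
  rintro v ⟨c, hc, d, hd, hc', hd', rfl⟩
  exact hmin c d hc hc' hd hd'
end

section
/- For any N ≥ 1 and any payoff function f : X^N → ℝ, the upper hedging price Ē_N(f) equals the maximum over all probability measures p on X^N under which the partial-sum process S_n = x_1 + … + x_n is a martingale (equivalently, for every n < N and every partial path ξⁿ of positive p-probability, the conditional distribution of x_{n+1} given ξⁿ is a risk-neutral measure on X) of the expectation E^p[f]. -/
/-- The finset of length-`n` paths with entries in `X`. -/
noncomputable def pathFinset (X : Finset ℝ) : ℕ → Finset (List ℝ)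
  | 0 => {[]}
  | n + 1 => (X ×ˢ pathFinset X n).image fun p => p.1 :: p.2

theorem mem_pathFinset {X : Finset ℝ} {n : ℕ} {ξ : List ℝ} :
    ξ ∈ pathFinset X n ↔ ξ.length = n ∧ ∀ x ∈ ξ, x ∈ X := by
  induction n generalizing ξ with
  | zero => simp +contextual [pathFinset]
  | succ n ih =>
    cases ξ with
    | nil => simp [pathFinset]
    | cons a ξ =>
      simp only [pathFinset, Finset.mem_image, Finset.mem_product, ih, Prod.exists,
        List.cons.injEq, List.length_cons, List.mem_cons, forall_eq_or_imp, Nat.add_right_cancel_iff]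
      constructor
      · rintro ⟨_, _, h, rfl, rfl⟩
        tauto
      · intro h
        exact ⟨a, ξ, by tauto, rfl, rfl⟩

theorem sum_pathFinset_succ (X : Finset ℝ) (n : ℕ) (f : List ℝ → ℝ) :
    ∑ ξ ∈ pathFinset X (n + 1), f ξ = ∑ a ∈ X, ∑ η ∈ pathFinset X n, f (a :: η) := by
  rw [pathFinset, Finset.sum_image, Finset.sum_product]
  rintro ⟨a, ξ⟩ _ ⟨b, η⟩ _ h
  simpa using h

/-- The weights `p` on paths of length `N` make the partial sums a martingale. -/
def IsMartingaleWeight (X : Finset ℝ) (N : ℕ) (p : List ℝ → ℝ) : Prop :=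
  ∀ n < N, ∀ ξ ∈ pathFinset X n,
    (∑ a ∈ X, a * ∑ η ∈ pathFinset X (N - (n + 1)), p (ξ ++ a :: η)) = 0

theorem isMartingaleWeight_succ {X : Finset ℝ} {N : ℕ} {p : List ℝ → ℝ} :
    IsMartingaleWeight X (N + 1) p ↔
      (∑ a ∈ X, a * ∑ η ∈ pathFinset X N, p (a :: η)) = 0 ∧
        ∀ a ∈ X, IsMartingaleWeight X N fun η => p (a :: η) := by
  constructor
  · intro h
    refine ⟨by simpa using h 0 N.succ_pos [] (by simp [pathFinset]), fun a ha n hn ξ hξ => ?_⟩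
    have hm : a :: ξ ∈ pathFinset X (n + 1) := by
      rw [mem_pathFinset] at hξ ⊢
      simpa [ha] using hξ
    simpa using h (n + 1) (by omega) (a :: ξ) hm
  · rintro ⟨h₀, h⟩ n hn ξ hξ
    cases n with
    | zero =>
      obtain rfl : ξ = [] := by simpa [pathFinset] using hξ
      simpa using h₀
    | succ n =>
      rw [mem_pathFinset] at hξ
      cases ξ with
      | nil => simp at hξ
      | cons a ξ =>
        have hξ' : ξ ∈ pathFinset X n := by
          rw [mem_pathFinset]
          exact ⟨by simpa using hξ.1, fun x hx => hξ.2 x (by simp [hx])⟩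
        simpa using h a (hξ.2 a (by simp)) n (by omega) ξ hξ'

/-- The capital process of any strategy has zero expectation under a martingale measure. -/
theorem IsMartingaleWeight.sum_capitalAux {X : Finset ℝ} {N : ℕ} {p : List ℝ → ℝ}
    (hp : IsMartingaleWeight X N p) (P : List ℝ → ℝ) (pre : List ℝ) :
    ∑ ξ ∈ pathFinset X N, capitalAux P pre ξ * p ξ = 0 := by
  induction N generalizing p pre with
  | zero => simp [pathFinset, capitalAux]
  | succ N ih =>
    obtain ⟨h₀, h⟩ := isMartingaleWeight_succ.1 hp
    simp only [sum_pathFinset_succ, capitalAux, add_mul, Finset.sum_add_distrib]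
    rw [Finset.sum_eq_zero fun a ha => ih (h a ha) (pre ++ [a]), add_zero]
    simp only [mul_assoc, ← Finset.mul_sum]
    rw [h₀, mul_zero]

theorem capitalAux_cons (P : List ℝ → ℝ) (a : ℝ) (pre ξ : List ℝ) :
    capitalAux P (a :: pre) ξ = capitalAux (fun l => P (a :: l)) pre ξ := by
  induction ξ generalizing pre with
  | nil => rfl
  | cons x ξ ih => simp [capitalAux, ih]

/-- The risk-neutral measure supported on two points of opposite sign. -/
theorem exists_riskNeutral_pair {X : Finset ℝ} {a b : ℝ} (ha : a ∈ X) (hb : b ∈ X)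
    (ha0 : a < 0) (hb0 : 0 < b) (g : ℝ → ℝ) :
    ∃ q : ℝ → ℝ, (∀ x ∈ X, 0 ≤ q x) ∧ ∑ x ∈ X, q x = 1 ∧ ∑ x ∈ X, x * q x = 0 ∧
      ∑ x ∈ X, g x * q x = (b * g a - a * g b) / (b - a) := by
  have hd : 0 < b - a := by linarith
  refine ⟨fun x => (if x = a then b / (b - a) else 0) + (if x = b then -a / (b - a) else 0),
    fun x _ => ?_, ?_, ?_, ?_⟩
  · have h₁ : 0 ≤ b / (b - a) := by positivity
    have h₂ : 0 ≤ -a / (b - a) := div_nonneg (by linarith) hd.le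
    dsimp only
    split_ifs <;> linarith
  all_goals
    simp only [mul_add, mul_ite, mul_zero, Finset.sum_add_distrib, Finset.sum_ite_eq', ha, hb,
      if_true]
    field_simp
    ring

/-- One-step duality: a cheapest superhedge of `g` together with a risk-neutral measure
attaining its cost. -/
theorem exists_oneStep_dual {X : Finset ℝ} (hneg : ∃ a ∈ X, a < 0) (hpos : ∃ a ∈ X, 0 < a)
    (g : ℝ → ℝ) :
    ∃ (β m : ℝ) (q : ℝ → ℝ), (∀ a ∈ X, g a ≤ β + m * a) ∧ (∀ a ∈ X, 0 ≤ q a) ∧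
      ∑ a ∈ X, q a = 1 ∧ ∑ a ∈ X, a * q a = 0 ∧ ∑ a ∈ X, g a * q a = β := by
  obtain ⟨a₀, ha₀, ha₀'⟩ := hneg
  obtain ⟨b₀, hb₀, hb₀'⟩ := hpos
  obtain ⟨⟨a, b⟩, hab, hmax⟩ := Finset.exists_max_image
    (X.filter (· < 0) ×ˢ X.filter (0 < ·))
    (fun s : ℝ × ℝ => (s.2 * g s.1 - s.1 * g s.2) / (s.2 - s.1))
    ⟨(a₀, b₀), by simp [*]⟩
  simp only [Finset.mem_product, Finset.mem_filter, Prod.forall] at hab hmax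
  obtain ⟨q, hq⟩ : ∃ q : ℝ → ℝ, (∀ x ∈ X, 0 ≤ q x) ∧ ∑ x ∈ X, q x = 1 ∧
      ∑ x ∈ X, x * q x = 0 ∧ ((0 : ℝ) ∈ X → g 0 ≤ ∑ x ∈ X, g x * q x) ∧
      (b * g a - a * g b) / (b - a) ≤ ∑ x ∈ X, g x * q x := by
    by_cases h : (0 : ℝ) ∈ X ∧ (b * g a - a * g b) / (b - a) < g 0
    · refine ⟨fun x => if x = 0 then 1 else 0, fun x _ => ?_, ?_, ?_, ?_, ?_⟩
      · dsimp only
        split_ifs <;> norm_num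
      · simp [h.1]
      · simp
      · simp [h.1]
      · simpa [h.1] using h.2.le
    · obtain ⟨q, h₁, h₂, h₃, h₄⟩ :=
        exists_riskNeutral_pair hab.1.1 hab.2.1 hab.1.2 hab.2.2 g
      refine ⟨q, h₁, h₂, h₃, fun h0 => ?_, h₄.ge⟩
      rw [h₄]
      exact not_lt.1 fun hlt => h ⟨h0, hlt⟩
  obtain ⟨hq₁, hq₂, hq₃, hq₄, hq₅⟩ := hq
  set β := ∑ x ∈ X, g x * q x
  obtain ⟨c, hc, hcmax⟩ := Finset.exists_max_image (X.filter (0 < ·)) (fun x => (g x - β) / x)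
    ⟨b₀, by simp [*]⟩
  simp only [Finset.mem_filter] at hc hcmax
  refine ⟨β, (g c - β) / c, q, fun x hx => ?_, hq₁, hq₂, hq₃, rfl⟩
  rcases lt_trichotomy x 0 with h | rfl | h
  · have h₁ := (hmax x c ⟨⟨hx, h⟩, hc⟩).trans hq₅
    have hc0 := hc.2
    rw [div_le_iff₀ (by linarith)] at h₁
    have h₂ : g x * c ≤ (β + (g c - β) / c * x) * c := by
      have : (β + (g c - β) / c * x) * c = β * c + (g c - β) * x := by field_simp
      linarith
    exact le_of_mul_le_mul_right h₂ hc0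
  · simpa using hq₄ hx
  · have h₁ := hcmax x ⟨hx, h⟩
    rw [div_le_iff₀ h] at h₁
    linarith

/-- Every payoff has a superhedge and a martingale measure whose expectation equals its cost. -/
theorem exists_multiStep_dual {X : Finset ℝ} (hneg : ∃ a ∈ X, a < 0) (hpos : ∃ a ∈ X, 0 < a)
    (N : ℕ) (F : List ℝ → ℝ) :
    ∃ (α : ℝ) (P p : List ℝ → ℝ), (∀ ξ ∈ pathFinset X N, F ξ ≤ α + capitalAux P [] ξ) ∧
      (∀ ξ ∈ pathFinset X N, 0 ≤ p ξ) ∧ ∑ ξ ∈ pathFinset X N, p ξ = 1 ∧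
      IsMartingaleWeight X N p ∧ ∑ ξ ∈ pathFinset X N, F ξ * p ξ = α := by
  induction N generalizing F with
  | zero =>
    exact ⟨F [], 0, 1, by simp [pathFinset, capitalAux], by simp, by simp [pathFinset],
      fun n hn => absurd hn n.not_lt_zero, by simp [pathFinset]⟩
  | succ N ih =>
    choose α P p hP hp hsum hmart hval using fun a : ℝ => ih fun ξ => F (a :: ξ)
    obtain ⟨β, m, q, hm, hq, hq₁, hq₀, hqβ⟩ := exists_oneStep_dual hneg hpos α
    have hmem {a : ℝ} {ξ : List ℝ} (h : a :: ξ ∈ pathFinset X (N + 1)) :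
        a ∈ X ∧ ξ ∈ pathFinset X N := by
      simp only [mem_pathFinset, List.length_cons, List.mem_cons, forall_eq_or_imp,
        Nat.add_right_cancel_iff] at h ⊢
      tauto
    have hnil : [] ∉ pathFinset X (N + 1) := by simp [mem_pathFinset]
    refine ⟨β, fun | [] => m | a :: l => P a l, fun | [] => 0 | a :: l => q a * p a l,
      fun ξ hξ => ?_, fun ξ hξ => ?_, ?_, isMartingaleWeight_succ.2 ⟨?_, ?_⟩, ?_⟩
    · cases ξ with
      | nil => exact absurd hξ hnil
      | cons a ξ =>
        obtain ⟨ha, hξ⟩ := hmem hξ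
        simp only [capitalAux, List.nil_append, capitalAux_cons]
        linarith [hP a ξ hξ, hm a ha]
    · cases ξ with
      | nil => exact absurd hξ hnil
      | cons a ξ =>
        obtain ⟨ha, hξ⟩ := hmem hξ
        exact mul_nonneg (hq a ha) (hp a ξ hξ)
    · simpa only [sum_pathFinset_succ, ← Finset.mul_sum, hsum, mul_one] using hq₁
    · simpa only [← Finset.mul_sum, hsum, mul_one] using hq₀
    · intro a _ n hn ξ hξ
      have := hmart a n hn ξ hξ
      simp only [← Finset.mul_sum, mul_left_comm _ (q a), this, mul_zero]
    · simp only [sum_pathFinset_succ, mul_left_comm _ (q _), ← Finset.mul_sum, hval]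
      simpa only [mul_comm] using hqβ

/-- Weak duality: expectations under martingale measures are bounded by superhedging costs. -/
theorem IsMartingaleWeight.sum_le {X : Finset ℝ} {N : ℕ} {p P F : List ℝ → ℝ} {α : ℝ}
    (hp : IsMartingaleWeight X N p) (hp₀ : ∀ ξ ∈ pathFinset X N, 0 ≤ p ξ)
    (hp₁ : ∑ ξ ∈ pathFinset X N, p ξ = 1)
    (hF : ∀ ξ ∈ pathFinset X N, F ξ ≤ α + capitalAux P [] ξ) :
    ∑ ξ ∈ pathFinset X N, F ξ * p ξ ≤ α :=
  calc ∑ ξ ∈ pathFinset X N, F ξ * p ξ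
      ≤ ∑ ξ ∈ pathFinset X N, (α + capitalAux P [] ξ) * p ξ :=
        Finset.sum_le_sum fun ξ hξ => mul_le_mul_of_nonneg_right (hF ξ hξ) (hp₀ ξ hξ)
    _ = α := by
        simp only [add_mul, Finset.sum_add_distrib, ← Finset.mul_sum, hp₁, hp.sum_capitalAux]
        ring

/-- Multi-step duality: for `N ≥ 1`, the upper hedging price of a payoff `F` equals the
maximum of `E^p[F]` over all probability measures `p` on `X^N` under which the partial-sum
process is a martingale (i.e. for every partial path, the conditional expectation of the
next move vanishes). -/
theorem multi_step_duality (X : Finset ℝ)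
    (hneg : ∃ a ∈ X, a < 0) (hpos : ∃ a ∈ X, 0 < a)
    (N : ℕ) (hN : 1 ≤ N) (F : List ℝ → ℝ) :
    IsGreatest
      {v : ℝ | ∃ p : List ℝ → ℝ,
        (∀ ξ ∈ pathFinset X N, 0 ≤ p ξ) ∧
        (∑ ξ ∈ pathFinset X N, p ξ) = 1 ∧
        (∀ n < N, ∀ ξ ∈ pathFinset X n,
          (∑ a ∈ X, a * ∑ η ∈ pathFinset X (N - (n + 1)), p (ξ ++ a :: η)) = 0) ∧
        v = ∑ ξ ∈ pathFinset X N, F ξ * p ξ}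
      (upperPrice X N F) := by
  obtain ⟨α, P, p, hP, hp₀, hp₁, hp, hval⟩ := exists_multiStep_dual hneg hpos N F
  have hprice : upperPrice X N F = α := by
    refine IsLeast.csInf_eq ⟨⟨P, fun ξ h₁ h₂ => hP ξ (mem_pathFinset.2 ⟨h₁, h₂⟩)⟩, ?_⟩
    rintro β ⟨Q, hQ⟩
    rw [← hval]
    refine hp.sum_le hp₀ hp₁ (P := Q) fun ξ hξ => ?_
    rw [mem_pathFinset] at hξ
    exact hQ ξ hξ.1 hξ.2
  rw [hprice]
  refine ⟨⟨p, hp₀, hp₁, hp, hval.symm⟩, ?_⟩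
  rintro v ⟨r, hr₀, hr₁, hr, rfl⟩
  exact IsMartingaleWeight.sum_le hr hr₀ hr₁ hP
end

section
/- Define f̄ on the set of sequences over X of length at most N by backward induction: f̄(ξ) = f(ξ) for ξ ∈ X^N, and for a sequence ξ of length n < N, f̄(ξ) = max over negative elements a⁻ of X and nonnegative elements a⁺ of X of (a⁺·f̄(ξa⁻) − a⁻·f̄(ξa⁺))/(a⁺ − a⁻), where ξa denotes ξ extended by a. Then the upper hedging price of f in the N-round game equals f̄(□), the value of f̄ at the empty sequence. -/
/-- Backward induction: `barF X F n ξ` is the value at node `ξ` with `n` remaining rounds,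
obtained by taking at each node the maximum of
`(ap * barF(ξ ++ [an]) - an * barF(ξ ++ [ap])) / (ap - an)`
over negative `an ∈ X` and nonnegative `ap ∈ X`. -/
noncomputable def barF (X : Finset ℝ) (F : List ℝ → ℝ) : ℕ → List ℝ → ℝ
  | 0, ξ => F ξ
  | n + 1, ξ => sSup {v : ℝ | ∃ an ∈ X, ∃ ap ∈ X, an < 0 ∧ 0 ≤ ap ∧
      v = (ap * barF X F n (ξ ++ [an]) - an * barF X F n (ξ ++ [ap])) / (ap - an)}

/-- The one-step upper price of `g` over `X` is a lower bound for every hedging capital. -/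
theorem oneStep_le_of_hedge (X : Finset ℝ) (g : ℝ → ℝ)
    (hneg : ∃ a ∈ X, a < 0) (hpos : ∃ a ∈ X, 0 < a) {α p : ℝ}
    (h : ∀ x ∈ X, g x ≤ α + p * x) :
    sSup {v : ℝ | ∃ an ∈ X, ∃ ap ∈ X, an < 0 ∧ 0 ≤ ap ∧
      v = (ap * g an - an * g ap) / (ap - an)} ≤ α := by
  obtain ⟨a, ha, ha0⟩ := hneg
  obtain ⟨b, hb, hb0⟩ := hpos
  refine csSup_le ⟨_, a, ha, b, hb, ha0, hb0.le, rfl⟩ ?_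
  rintro v ⟨an, han, ap, hap, hn, hp, rfl⟩
  rw [div_le_iff₀ (by linarith)]
  have h1 := mul_le_mul_of_nonneg_left (h an han) hp
  have h2 := mul_le_mul_of_nonneg_left (h ap hap) (neg_nonneg.2 hn.le)
  linarith

/-- The one-step upper price of `g` over `X` suffices to hedge `g` in one round. -/
theorem exists_hedge_oneStep (X : Finset ℝ) (g : ℝ → ℝ)
    (hneg : ∃ a ∈ X, a < 0) (hpos : ∃ a ∈ X, 0 < a) :
    ∃ p : ℝ, ∀ x ∈ X, g x ≤ sSup {v : ℝ | ∃ an ∈ X, ∃ ap ∈ X, an < 0 ∧ 0 ≤ ap ∧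
      v = (ap * g an - an * g ap) / (ap - an)} + p * x := by
  set S := {v : ℝ | ∃ an ∈ X, ∃ ap ∈ X, an < 0 ∧ 0 ≤ ap ∧
      v = (ap * g an - an * g ap) / (ap - an)} with hS
  have hfin : S.Finite := by
    refine ((X ×ˢ X).finite_toSet.image
      fun q : ℝ × ℝ => (q.2 * g q.1 - q.1 * g q.2) / (q.2 - q.1)).subset ?_
    rintro v ⟨an, han, ap, hap, -, -, rfl⟩
    exact ⟨(an, ap), by simp [han, hap], rfl⟩
  have key : ∀ an ∈ X, ∀ ap ∈ X, an < 0 → 0 ≤ ap →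
      ap * g an - an * g ap ≤ sSup S * (ap - an) := fun an han ap hap hn hp => by
    rw [← div_le_iff₀ (by linarith)]
    exact le_csSup hfin.bddAbove ⟨an, han, ap, hap, hn, hp, rfl⟩
  obtain ⟨a, ha, ha0⟩ := hneg
  obtain ⟨b, hb, hbmax⟩ := (X.filter (0 < ·)).exists_max_image (fun x => (g x - sSup S) / x)
    (by obtain ⟨b, hb, hb0⟩ := hpos; exact ⟨b, by simp [hb, hb0]⟩)
  rw [Finset.mem_filter] at hb
  obtain ⟨hb, hb0⟩ := hb
  refine ⟨(g b - sSup S) / b, fun x hx => ?_⟩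
  rcases lt_trichotomy x 0 with hx0 | rfl | hx0
  · have h := key x hx b hb hx0 hb0.le
    have : g x - sSup S ≤ (g b - sSup S) * x / b := by
      rw [le_div_iff₀ hb0]
      linarith
    rw [div_mul_eq_mul_div]
    linarith
  · have h := key a ha 0 hx ha0 le_rfl
    nlinarith
  · have h := hbmax x (by simp [hx, hx0])
    rw [div_le_iff₀ hx0] at h
    linarith

/-- A capital that hedges `F` from the node `pre` with `n` rounds left is at least `barF`. -/
theorem barF_le_of_hedge (X : Finset ℝ) (hneg : ∃ a ∈ X, a < 0) (hpos : ∃ a ∈ X, 0 < a)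
    (F P : List ℝ → ℝ) (n : ℕ) (pre : List ℝ) (α : ℝ)
    (h : ∀ ξ : List ℝ, ξ.length = n → (∀ x ∈ ξ, x ∈ X) →
      F (pre ++ ξ) ≤ α + capitalAux P pre ξ) :
    barF X F n pre ≤ α := by
  induction n generalizing pre α with
  | zero => simpa [barF, capitalAux] using h [] rfl (by simp)
  | succ n ih =>
    refine oneStep_le_of_hedge X (fun x => barF X F n (pre ++ [x])) hneg hpos (p := P pre)
      fun x hx => ih _ _ fun ξ hξ hξX => ?_
    have := h (x :: ξ) (by simp [hξ]) (by simpa [hx] using hξX)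
    simpa [capitalAux, add_assoc] using this

/-- A strategy that hedges every single round of the backward induction hedges `F`. -/
theorem le_barF_add_capitalAux (X : Finset ℝ) (F P : List ℝ → ℝ) (N : ℕ)
    (hP : ∀ n pre, pre.length + (n + 1) = N → ∀ x ∈ X,
      barF X F n (pre ++ [x]) ≤ barF X F (n + 1) pre + P pre * x)
    (n : ℕ) (pre ξ : List ℝ) (hN : pre.length + n = N) (hξ : ξ.length = n)
    (hξX : ∀ x ∈ ξ, x ∈ X) :
    F (pre ++ ξ) ≤ barF X F n pre + capitalAux P pre ξ := by
  induction ξ generalizing n pre with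
  | nil =>
    subst hξ
    simp [barF, capitalAux]
  | cons x ξ ih =>
    subst hξ
    have h1 := ih ξ.length (pre ++ [x]) (by simp at hN ⊢; omega) rfl
      fun y hy => hξX y (by simp [hy])
    have h2 := hP ξ.length pre hN x (hξX x (by simp))
    simp only [List.append_assoc, List.singleton_append] at h1
    simp only [capitalAux, List.length_cons]
    linarith

/-- The upper hedging price of `F` in the `N`-round game equals the value of the
backward induction at the empty path. -/
theorem upper_price_backward_induction (X : Finset ℝ)
    (hneg : ∃ a ∈ X, a < 0) (hpos : ∃ a ∈ X, 0 < a)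
    (N : ℕ) (F : List ℝ → ℝ) :
    upperPrice X N F = barF X F N [] := by
  have hstep : ∀ pre : List ℝ, ∃ p : ℝ, ∀ x ∈ X, barF X F (N - pre.length - 1) (pre ++ [x]) ≤
      barF X F (N - pre.length - 1 + 1) pre + p * x := fun pre =>
    exists_hedge_oneStep X (fun x => barF X F (N - pre.length - 1) (pre ++ [x])) hneg hpos
  choose P hP using hstep
  refine IsLeast.csInf_eq ⟨⟨P, fun ξ hξ hξX => ?_⟩, ?_⟩
  · refine le_barF_add_capitalAux X F P N (fun n pre hn => ?_) N [] ξ (by simp) hξ hξX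
    obtain rfl : n = N - pre.length - 1 := by omega
    exact hP pre
  · rintro α ⟨Q, hQ⟩
    exact barF_le_of_hedge X hneg hpos F Q N [] α hQ
end

section
/- Let f : ℝ^N → ℝ be convex, let a_l⁻ be the minimum (most negative) element of X and a_m⁺ the maximum (most positive) element of X. Then the upper hedging price of the restriction of f to X^N in the N-round game equals the binomial price E_{a_l⁻,a_m⁺}(f), i.e. the expectation of f under the i.i.d. product measure on {a_l⁻, a_m⁺}^N in which each coordinate equals a_l⁻ with probability a_m⁺/(a_m⁺ − a_l⁻) and equals a_m⁺ with probability −a_l⁻/(a_m⁺ − a_l⁻). -/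
/-- The binomial price of a European-type payoff `f : ℝ^N → ℝ` for the binomial model
`{an, ap}` with `an < 0 < ap`: the expectation of `f` under the i.i.d. product measure in
which each coordinate equals `an` with probability `ap / (ap - an)` and equals `ap` with
probability `-an / (ap - an)`. -/
noncomputable def binPrice (N : ℕ) (an ap : ℝ) (f : (Fin N → ℝ) → ℝ) : ℝ :=
  ∑ ε : Fin N → Bool,
    (∏ i, (if ε i then -an else ap) / (ap - an)) * f (fun i => if ε i then ap else an)

theorem capitalAux_cons_prefix (P : List ℝ → ℝ) (x : ℝ) (pre ξ : List ℝ) :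
    capitalAux P (x :: pre) ξ = capitalAux (fun l => P (x :: l)) pre ξ := by
  induction ξ generalizing pre with
  | nil => rfl
  | cons y ξ ih => simp [capitalAux, ← ih]

theorem capitalAux_nil_cons (P : List ℝ → ℝ) (x : ℝ) (ξ : List ℝ) :
    capitalAux P [] (x :: ξ) = P [] * x + capitalAux (fun l => P (x :: l)) [] ξ := by
  simp [capitalAux, capitalAux_cons_prefix]

theorem binPrice_zero (an ap : ℝ) (f : (Fin 0 → ℝ) → ℝ) (v : Fin 0 → ℝ) :
    binPrice 0 an ap f = f v := by
  simp [binPrice, Subsingleton.elim _ v]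

theorem binPrice_succ (N : ℕ) (an ap : ℝ) (f : (Fin (N + 1) → ℝ) → ℝ) :
    binPrice (N + 1) an ap f =
      ap / (ap - an) * binPrice N an ap (fun v => f (Fin.cons an v)) +
        -an / (ap - an) * binPrice N an ap (fun v => f (Fin.cons ap v)) := by
  have hcons (b : Bool) (ε : Fin N → Bool) :
      (fun i => if (Fin.cons b ε : Fin (N + 1) → Bool) i then ap else an) =
        (Fin.cons (if b then ap else an) (fun i => if ε i then ap else an) :
          Fin (N + 1) → ℝ) := by
    funext i
    refine Fin.cases ?_ (fun j => ?_) i <;> simp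
  unfold binPrice
  rw [← (Fin.consEquiv (fun _ : Fin (N + 1) => Bool)).sum_comp, Fintype.sum_prod_type]
  simp only [Fin.consEquiv_apply, hcons, Fin.prod_univ_succ, Fin.cons_zero,
    Fin.cons_succ, Fintype.sum_bool, Finset.mul_sum, mul_assoc, if_true, Bool.false_eq_true,
    if_false]
  rw [add_comm]

theorem binPrice_mono (N : ℕ) {an ap : ℝ} (han : an < 0) (hap : 0 < ap)
    {f g : (Fin N → ℝ) → ℝ} (hfg : ∀ v, f v ≤ g v) :
    binPrice N an ap f ≤ binPrice N an ap g := by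
  refine Finset.sum_le_sum fun ε _ => mul_le_mul_of_nonneg_left (hfg _) ?_
  refine Finset.prod_nonneg fun i _ => div_nonneg ?_ (by linarith)
  split_ifs <;> linarith

theorem binPrice_linear (N : ℕ) (an ap s t : ℝ) (f g : (Fin N → ℝ) → ℝ) :
    binPrice N an ap (fun v => s * f v + t * g v) =
      s * binPrice N an ap f + t * binPrice N an ap g := by
  unfold binPrice
  rw [Finset.mul_sum, Finset.mul_sum, ← Finset.sum_add_distrib]
  exact Finset.sum_congr rfl fun ε _ => by ring

theorem convexOn_comp_cons {N : ℕ} {f : (Fin (N + 1) → ℝ) → ℝ} (hf : ConvexOn ℝ Set.univ f)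
    (x : ℝ) : ConvexOn ℝ Set.univ (fun v : Fin N → ℝ => f (Fin.cons x v)) := by
  refine ⟨convex_univ, fun u _ v _ s t hs ht hst => ?_⟩
  have h := hf.2 (Set.mem_univ (Fin.cons x u)) (Set.mem_univ (Fin.cons x v)) hs ht hst
  have hx : s • (Fin.cons x u : Fin (N + 1) → ℝ) + t • (Fin.cons x v : Fin (N + 1) → ℝ) =
      Fin.cons x (s • u + t • v) := by
    funext i
    refine Fin.cases ?_ (fun j => ?_) i
    · simp [← add_mul, hst]
    · simp
  rwa [hx] at h

/-- The binomial price of a convex payoff, as a function of the first move, lies below its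
chord over `[an, ap]`. -/
theorem binPrice_cons_le_chord {N : ℕ} {an ap : ℝ} (han : an < 0) (hap : 0 < ap)
    {f : (Fin (N + 1) → ℝ) → ℝ} (hf : ConvexOn ℝ Set.univ f) {x : ℝ} (hx : x ∈ Set.Icc an ap) :
    binPrice N an ap (fun v => f (Fin.cons x v)) ≤
      (ap - x) / (ap - an) * binPrice N an ap (fun v => f (Fin.cons an v)) +
        (x - an) / (ap - an) * binPrice N an ap (fun v => f (Fin.cons ap v)) := by
  have hd : 0 < ap - an := by linarith
  rw [← binPrice_linear]
  refine binPrice_mono N han hap fun v => ?_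
  have hst : (ap - x) / (ap - an) + (x - an) / (ap - an) = 1 := by field_simp; ring
  have h := hf.2 (Set.mem_univ (Fin.cons an v)) (Set.mem_univ (Fin.cons ap v))
    (div_nonneg (sub_nonneg.2 hx.2) hd.le) (div_nonneg (sub_nonneg.2 hx.1) hd.le) hst
  have hcons : ((ap - x) / (ap - an)) • (Fin.cons an v : Fin (N + 1) → ℝ) +
      ((x - an) / (ap - an)) • (Fin.cons ap v : Fin (N + 1) → ℝ) = Fin.cons x v := by
    funext i
    refine Fin.cases ?_ (fun j => ?_) i
    · simp only [Pi.add_apply, Pi.smul_apply, Fin.cons_zero, smul_eq_mul]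
      field_simp
      ring
    · simp only [Pi.add_apply, Pi.smul_apply, Fin.cons_succ, smul_eq_mul]
      rw [← add_mul, hst, one_mul]
  rwa [hcons] at h

/-- The binomial price suffices to superhedge a convex payoff along all paths in `[an, ap]`. -/
theorem exists_superhedge_of_convexOn {an ap : ℝ} (han : an < 0) (hap : 0 < ap) (N : ℕ)
    (f : (Fin N → ℝ) → ℝ) (hf : ConvexOn ℝ Set.univ f) :
    ∃ P : List ℝ → ℝ, ∀ v : Fin N → ℝ, (∀ i, v i ∈ Set.Icc an ap) →
      f v ≤ binPrice N an ap f + capitalAux P [] (List.ofFn v) := by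
  induction N with
  | zero => exact ⟨0, fun v _ => by simp [binPrice_zero an ap f v, capitalAux]⟩
  | succ N ih =>
    choose Q hQ using fun x => ih (fun v => f (Fin.cons x v)) (convexOn_comp_cons hf x)
    set V : ℝ → ℝ := fun x => binPrice N an ap (fun v => f (Fin.cons x v))
    let P : List ℝ → ℝ
      | [] => (V ap - V an) / (ap - an)
      | x :: l => Q x l
    refine ⟨P, fun v hv => ?_⟩
    have htail := hQ (v 0) (Fin.tail v) fun i => hv i.succ
    rw [Fin.cons_self_tail] at htail
    have hchord := binPrice_cons_le_chord han hap hf (hv 0)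
    have hd : ap - an ≠ 0 := by linarith
    have hsplit : (ap - v 0) / (ap - an) * V an + (v 0 - an) / (ap - an) * V ap =
        ap / (ap - an) * V an + -an / (ap - an) * V ap +
          (V ap - V an) / (ap - an) * v 0 := by
      field_simp
      ring
    rw [List.ofFn_succ, capitalAux_nil_cons, binPrice_succ]
    change f v ≤ ap / (ap - an) * V an + -an / (ap - an) * V ap +
      ((V ap - V an) / (ap - an) * v 0 + capitalAux (Q (v 0)) [] (List.ofFn (Fin.tail v)))
    change V (v 0) ≤ (ap - v 0) / (ap - an) * V an + (v 0 - an) / (ap - an) * V ap at hchord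
    change f v ≤ V (v 0) + _ at htail
    linarith

/-- Any initial capital superhedging a payoff along the paths in `{an, ap}` is at least its
binomial price. -/
theorem binPrice_le_of_superhedge {an ap : ℝ} (han : an < 0) (hap : 0 < ap) (N : ℕ)
    (f : (Fin N → ℝ) → ℝ) (α : ℝ) (P : List ℝ → ℝ)
    (h : ∀ v : Fin N → ℝ, (∀ i, v i = an ∨ v i = ap) →
      f v ≤ α + capitalAux P [] (List.ofFn v)) :
    binPrice N an ap f ≤ α := by
  induction N generalizing α P with
  | zero => simpa [binPrice_zero an ap f Fin.elim0, capitalAux] using h Fin.elim0 fun i => i.elim0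
  | succ N ih =>
    have hstep (x : ℝ) (hx : x = an ∨ x = ap) :
        binPrice N an ap (fun v => f (Fin.cons x v)) ≤ α + P [] * x := by
      refine ih _ _ (fun l => P (x :: l)) fun v hv => ?_
      have hc := h (Fin.cons x v) fun i => Fin.cases hx hv i
      rw [List.ofFn_succ, capitalAux_nil_cons] at hc
      simp only [Fin.cons_zero, Fin.cons_succ] at hc
      linarith
    have hd : 0 < ap - an := by linarith
    rw [binPrice_succ]
    calc
      _ ≤ ap / (ap - an) * (α + P [] * an) + -an / (ap - an) * (α + P [] * ap) := by
        gcongr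
        · exact hstep an (.inl rfl)
        · exact div_nonneg (by linarith) hd.le
        · exact hstep ap (.inr rfl)
      _ = α := by
        field_simp
        ring

/-- For a convex payoff `f : ℝ^N → ℝ`, the upper hedging price of its restriction to
`X^N` is given by the binomial model on the two outermost values of `X`. -/
theorem upper_price_convex (X : Finset ℝ)
    (hneg : ∃ a ∈ X, a < 0) (hpos : ∃ a ∈ X, 0 < a)
    (N : ℕ) (f : (Fin N → ℝ) → ℝ) (hf : ConvexOn ℝ Set.univ f)
    (alneg ampos : ℝ)
    (hal : IsLeast (↑X : Set ℝ) alneg) (ham : IsGreatest (↑X : Set ℝ) ampos) :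
    upperPrice X N (fun ξ => f (fun i => ξ.getD (i : ℕ) 0)) = binPrice N alneg ampos f := by
  obtain ⟨a, haX, ha⟩ := hneg
  obtain ⟨b, hbX, hb⟩ := hpos
  have han : alneg < 0 := (hal.2 haX).trans_lt ha
  have hap : 0 < ampos := hb.trans_le (ham.2 hbX)
  refine IsLeast.csInf_eq ⟨?_, ?_⟩
  · obtain ⟨P, hP⟩ := exists_superhedge_of_convexOn han hap N f hf
    refine ⟨P, fun ξ hlen hξ => ?_⟩
    subst hlen
    have hget : (fun i : Fin ξ.length => ξ.getD (i : ℕ) 0) = ξ.get := by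
      funext i
      simp
    simp only [hget]
    have h := hP ξ.get fun i =>
      ⟨hal.2 (hξ _ (ξ.get_mem i)), ham.2 (hξ _ (ξ.get_mem i))⟩
    rwa [List.ofFn_get] at h
  · rintro α ⟨P, hP⟩
    refine binPrice_le_of_superhedge han hap N f α P fun v hv => ?_
    have h := hP (List.ofFn v) (List.length_ofFn) fun x hx => by
      obtain ⟨i, rfl⟩ := (List.mem_ofFn' v x).1 hx
      rcases hv i with h | h <;> rw [h]
      exacts [hal.1, ham.1]
    simpa using h
end

section
/- Let f : ℝ^N → ℝ be convex and suppose 0 ∈ X. Then the lower hedging price of the restriction of f to X^N in the N-round game equals f(0, 0, …, 0). -/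
/-- A continuous convex function on a topological vector space has a subgradient at each point. -/
theorem ConvexOn.exists_subgradient {E : Type*} [TopologicalSpace E] [AddCommGroup E]
    [IsTopologicalAddGroup E] [Module ℝ E] [ContinuousSMul ℝ E] {φ : E → ℝ}
    (hφ : ConvexOn ℝ Set.univ φ) (hc : Continuous φ) (x₀ : E) :
    ∃ l : E →L[ℝ] ℝ, ∀ x, φ x₀ + l (x - x₀) ≤ φ x := by
  have hconv : Convex ℝ {p : E × ℝ | φ p.1 < p.2} := by
    simpa using hφ.convex_strict_epigraph
  have hopen : IsOpen {p : E × ℝ | φ p.1 < p.2} :=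
    isOpen_lt (hc.comp continuous_fst) continuous_snd
  obtain ⟨L, hL⟩ := geometric_hahn_banach_point_open hconv hopen
    (x := (x₀, φ x₀)) (by simp)
  have hsplit (x : E) (t : ℝ) : L (x, t) = L (x, 0) + t * L (0, 1) := by
    rw [← smul_eq_mul, ← map_smul, ← map_add]
    simp
  have hpos : 0 < L (0, 1) := by
    have h := hL (x₀, φ x₀ + 1) (by simp)
    rw [hsplit, hsplit x₀ (φ x₀ + 1)] at h
    linarith
  refine ⟨-(L (0, 1))⁻¹ • L.comp (.inl ℝ E ℝ), fun x ↦ le_of_forall_pos_lt_add fun ε hε ↦ ?_⟩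
  have h := hL (x, φ x + ε) (by simpa using hε)
  rw [hsplit, hsplit x] at h
  have hsub : L (x - x₀, 0) = L (x, 0) - L (x₀, 0) := by
    rw [← map_sub]
    simp
  simp only [smul_apply, ContinuousLinearMap.comp_apply, ContinuousLinearMap.inl_apply, hsub,
    smul_eq_mul]
  rw [← mul_lt_mul_iff_left₀ hpos]
  field_simp
  linarith

theorem capitalAux_comp_length (g : ℕ → ℝ) (pre ξ : List ℝ) :
    capitalAux (fun p ↦ g p.length) pre ξ =
      ∑ i ∈ Finset.range ξ.length, g (pre.length + i) * ξ.getD i 0 := by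
  induction ξ generalizing pre with
  | nil => simp [capitalAux]
  | cons x rest ih =>
    rw [capitalAux, ih, List.length_cons, Finset.sum_range_succ', add_comm]
    simp [add_assoc, add_comm 1]

theorem capitalAux_replicate_zero (P : List ℝ → ℝ) (pre : List ℝ) (n : ℕ) :
    capitalAux P pre (List.replicate n 0) = 0 := by
  induction n generalizing pre with
  | zero => simp [capitalAux]
  | succ n ih => simp [List.replicate_succ, capitalAux, ih]

/-- For a convex payoff `f : ℝ^N → ℝ`, if `0 ∈ X` then the lower hedging price of the
restriction of `f` to `X^N` equals `f (0, …, 0)`. -/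
theorem lower_price_convex_zero_mem (X : Finset ℝ)
    (hneg : ∃ a ∈ X, a < 0) (hpos : ∃ a ∈ X, 0 < a) (h0 : (0 : ℝ) ∈ X)
    (N : ℕ) (f : (Fin N → ℝ) → ℝ) (hf : ConvexOn ℝ Set.univ f) :
    lowerPrice X N (fun ξ => f (fun i => ξ.getD (i : ℕ) 0)) = f (fun _ => 0) := by
  obtain ⟨l, hl⟩ := hf.exists_subgradient hf.locallyLipschitz.continuous 0
  rw [lowerPrice, upperPrice, neg_eq_iff_eq_neg]
  refine IsLeast.csInf_eq ⟨?_, ?_⟩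
  · let g : ℕ → ℝ := fun i ↦ if h : i < N then -l (Pi.single ⟨i, h⟩ 1) else 0
    refine ⟨fun p ↦ g p.length, fun ξ hξ _ ↦ ?_⟩
    have hcap : capitalAux (fun p ↦ g p.length) [] ξ = -l (fun i ↦ ξ.getD (i : ℕ) 0) := by
      rw [capitalAux_comp_length, hξ, Finset.sum_range,
        ← l.coe_coe, LinearMap.pi_apply_eq_sum_univ, ← Finset.sum_neg_distrib]
      refine Finset.sum_congr rfl fun i _ ↦ ?_
      have hsingle : (Pi.single i 1 : Fin N → ℝ) = fun j ↦ if i = j then 1 else 0 := by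
        ext j
        simp [Pi.single_apply, eq_comm]
      simp [g, ← hsingle, mul_comm]
    have h := hl fun i ↦ ξ.getD (i : ℕ) 0
    rw [sub_zero] at h
    rw [hcap]
    change f (fun _ ↦ 0) + _ ≤ _ at h
    linarith
  · rintro α ⟨P, hP⟩
    have h := hP (List.replicate N 0) (by simp) fun x hx ↦ by
      rwa [List.eq_of_mem_replicate hx]
    rw [capitalAux_replicate_zero, add_zero] at h
    simpa [List.getD_replicate] using h
end

section
/- Let f : ℝ^N → ℝ be convex in each coordinate separately (i.e. for every i and every fixed values of the other coordinates, x_i ↦ f(x_1,…,x_N) is convex), let a_l⁻ be the minimum element of X and a_m⁺ the maximum element of X. Then the upper hedging price of the restriction of f to X^N in the N-round game equals the binomial price E_{a_l⁻,a_m⁺}(f). -/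
/-- The binomial value, `n` rounds before expiry and after the moves `pre`, of the payoff `F`. -/
noncomputable def binValue (an ap : ℝ) (F : List ℝ → ℝ) : ℕ → List ℝ → ℝ
  | 0, pre => F pre
  | n + 1, pre =>
    ap / (ap - an) * binValue an ap F n (pre ++ [an]) +
      -an / (ap - an) * binValue an ap F n (pre ++ [ap])

theorem binValue_eq_sum (an ap : ℝ) (F : List ℝ → ℝ) (n : ℕ) (pre : List ℝ) :
    binValue an ap F n pre = ∑ ε : Fin n → Bool,
      (∏ i, (if ε i then -an else ap) / (ap - an)) *
        F (pre ++ List.ofFn fun i => if ε i then ap else an) := by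
  induction n generalizing pre with
  | zero => simp [binValue]
  | succ n ih =>
    rw [binValue, ih, ih, ← Equiv.sum_comp (Fin.consEquiv fun _ : Fin (n + 1) => Bool),
      Fintype.sum_prod_type, Fintype.sum_bool, add_comm]
    simp [Fin.consEquiv, Fin.prod_univ_succ, List.ofFn_succ, Finset.mul_sum, mul_assoc,
      -Finset.prod_div_distrib]

theorem binValue_nil_eq_binPrice (an ap : ℝ) (N : ℕ) (f : (Fin N → ℝ) → ℝ) :
    binValue an ap (fun ξ => f fun i => ξ.getD (i : ℕ) 0) N [] = binPrice N an ap f := by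
  simp [binValue_eq_sum, binPrice]

theorem binValue_le_of_superhedge {an ap : ℝ} (han : an < 0) (hap : 0 < ap) {X : Finset ℝ}
    (hanX : an ∈ X) (hapX : ap ∈ X) (F P : List ℝ → ℝ) (n : ℕ) (pre : List ℝ) (α : ℝ)
    (h : ∀ ξ : List ℝ, ξ.length = n → (∀ x ∈ ξ, x ∈ X) →
      F (pre ++ ξ) ≤ α + capitalAux P pre ξ) :
    binValue an ap F n pre ≤ α := by
  induction n generalizing pre α with
  | zero => simpa [binValue, capitalAux] using h [] rfl (by simp)
  | succ n ih =>
    have step (x : ℝ) (hx : x ∈ X) : binValue an ap F n (pre ++ [x]) ≤ α + P pre * x := by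
      refine ih _ _ fun ξ hlen hmem => ?_
      have := h (x :: ξ) (by simp [hlen]) (by simpa [hx] using hmem)
      simpa [capitalAux, add_assoc] using this
    have hd : 0 < ap - an := by linarith
    calc binValue an ap F (n + 1) pre
        ≤ ap / (ap - an) * (α + P pre * an) + -an / (ap - an) * (α + P pre * ap) :=
          add_le_add (mul_le_mul_of_nonneg_left (step an hanX) (by positivity))
            (mul_le_mul_of_nonneg_left (step ap hapX) (div_nonneg (by linarith) hd.le))
      _ = α := by field_simp; ring

theorem ConvexOn.le_binomial_chord {g : ℝ → ℝ} (hg : ConvexOn ℝ Set.univ g) {an ap x : ℝ}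
    (hlt : an < ap) (h₁ : an ≤ x) (h₂ : x ≤ ap) :
    g x ≤ ap / (ap - an) * g an + -an / (ap - an) * g ap + (g ap - g an) / (ap - an) * x := by
  have hd : 0 < ap - an := by linarith
  have h := hg.2 (Set.mem_univ an) (Set.mem_univ ap)
    (div_nonneg (sub_nonneg.2 h₂) hd.le) (div_nonneg (sub_nonneg.2 h₁) hd.le)
    (by field_simp; ring)
  have hx : ((ap - x) / (ap - an)) • an + ((x - an) / (ap - an)) • ap = x := by
    simp only [smul_eq_mul]; field_simp; ring
  rw [hx] at h
  refine h.trans_eq ?_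
  simp only [smul_eq_mul]; field_simp; ring

theorem convexOn_binValue {an ap : ℝ} (han : an < 0) (hap : 0 < ap) {N : ℕ} {F : List ℝ → ℝ}
    (hF : ∀ pre suf : List ℝ, pre.length + 1 + suf.length = N →
      ConvexOn ℝ Set.univ fun t : ℝ => F (pre ++ t :: suf))
    (n : ℕ) (pre suf : List ℝ) (hlen : pre.length + 1 + suf.length + n = N) :
    ConvexOn ℝ Set.univ fun t : ℝ => binValue an ap F n (pre ++ t :: suf) := by
  induction n generalizing suf with
  | zero => exact hF pre suf hlen
  | succ n ih =>
    have hd : 0 < ap - an := by linarith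
    have step (a : ℝ) := ih (suf ++ [a]) (by simp; omega)
    simp only [binValue, List.append_assoc, List.cons_append]
    exact ((step an).smul (c := ap / (ap - an)) (by positivity)).add
      ((step ap).smul (c := -an / (ap - an)) (div_nonneg (by linarith) hd.le))

/-- The strategy replicating `F` in the `N`-round binomial model with moves `an` and `ap`. -/
noncomputable def binHedge (an ap : ℝ) (F : List ℝ → ℝ) (N : ℕ) (pre : List ℝ) : ℝ :=
  (binValue an ap F (N - (pre.length + 1)) (pre ++ [ap]) -
    binValue an ap F (N - (pre.length + 1)) (pre ++ [an])) / (ap - an)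

theorem le_binValue_add_capitalAux_binHedge {an ap : ℝ} (han : an < 0) (hap : 0 < ap) {N : ℕ}
    {F : List ℝ → ℝ}
    (hF : ∀ pre suf : List ℝ, pre.length + 1 + suf.length = N →
      ConvexOn ℝ Set.univ fun t : ℝ => F (pre ++ t :: suf))
    (ξ pre : List ℝ) (hlen : pre.length + ξ.length = N) (hξ : ∀ x ∈ ξ, an ≤ x ∧ x ≤ ap) :
    F (pre ++ ξ) ≤ binValue an ap F ξ.length pre + capitalAux (binHedge an ap F N) pre ξ := by
  induction ξ generalizing pre with
  | nil => simp [binValue, capitalAux]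
  | cons x ξ ih =>
    simp only [List.length_cons] at hlen
    have hx := hξ x (by simp)
    have htail := ih (pre ++ [x]) (by simp; omega) fun y hy => hξ y (by simp [hy])
    have hchord := (convexOn_binValue han hap hF ξ.length pre [] (by simp; omega)).le_binomial_chord
      (han.trans hap) hx.1 hx.2
    have hN : N - (pre.length + 1) = ξ.length := by omega
    rw [List.append_assoc, List.singleton_append] at htail
    simp only [List.length_cons, binValue, capitalAux]
    rw [binHedge, hN]
    linarith

theorem convexOn_comp_getD {N : ℕ} {f : (Fin N → ℝ) → ℝ}
    (hf : ∀ (i : Fin N) (x : Fin N → ℝ),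
      ConvexOn ℝ Set.univ (fun t : ℝ => f (Function.update x i t)))
    (pre suf : List ℝ) (hlen : pre.length + 1 + suf.length = N) :
    ConvexOn ℝ Set.univ fun t : ℝ => f fun i : Fin N => (pre ++ t :: suf).getD (i : ℕ) 0 := by
  convert hf ⟨pre.length, by omega⟩ (fun i => (pre ++ 0 :: suf).getD (i : ℕ) 0) using 3 with t
  ext j
  rcases eq_or_ne j ⟨pre.length, by omega⟩ with rfl | hj
  · simp
  · have hj' : (j : ℕ) ≠ pre.length := fun h => hj (Fin.ext h)
    rw [Function.update_of_ne hj]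
    rcases lt_or_gt_of_ne hj' with h | h
    · simp [List.getElem?_append_left h]
    · obtain ⟨k, hk⟩ := Nat.exists_eq_add_of_lt h
      simp [hk, List.getElem?_append_right, add_assoc]

/-- For a payoff `f : ℝ^N → ℝ` which is convex in each coordinate separately, the upper
hedging price of its restriction to `X^N` is given by the binomial model on the two
outermost values of `X`. -/
theorem upper_price_componentwise_convex (X : Finset ℝ)
    (hneg : ∃ a ∈ X, a < 0) (hpos : ∃ a ∈ X, 0 < a)
    (N : ℕ) (f : (Fin N → ℝ) → ℝ)
    (hf : ∀ (i : Fin N) (x : Fin N → ℝ),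
      ConvexOn ℝ Set.univ (fun t : ℝ => f (Function.update x i t)))
    (alneg ampos : ℝ)
    (hal : IsLeast (↑X : Set ℝ) alneg) (ham : IsGreatest (↑X : Set ℝ) ampos) :
    upperPrice X N (fun ξ => f (fun i => ξ.getD (i : ℕ) 0)) = binPrice N alneg ampos f := by
  obtain ⟨a, haX, ha⟩ := hneg
  obtain ⟨b, hbX, hb⟩ := hpos
  have han : alneg < 0 := (hal.2 haX).trans_lt ha
  have hap : 0 < ampos := hb.trans_le (ham.2 hbX)
  rw [← binValue_nil_eq_binPrice]
  set F : List ℝ → ℝ := fun ξ => f fun i => ξ.getD (i : ℕ) 0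
  refine IsLeast.csInf_eq ⟨⟨binHedge alneg ampos F N, fun ξ hlen hξ => ?_⟩, ?_⟩
  · have h := le_binValue_add_capitalAux_binHedge (F := F) han hap (convexOn_comp_getD hf) ξ []
      (by simpa using hlen) fun x hx => ⟨hal.2 (hξ x hx), ham.2 (hξ x hx)⟩
    rwa [hlen] at h
  · rintro α ⟨P, hP⟩
    exact binValue_le_of_superhedge han hap hal.1 ham.1 F P N [] α hP
end

section
/- For any payoff function f : X^N → ℝ and any elements a⁻ < 0 < a⁺ of X, the binomial price E_{a⁻,a⁺}(f) (computed from the restriction of f to {a⁻,a⁺}^N) satisfies E̲_N(f) ≤ E_{a⁻,a⁺}(f) ≤ Ē_N(f), where Ē_N and E̲_N are the upper and lower hedging prices in the N-round game with move space X. -/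
/-- The binomial price of a (possibly path-dependent) payoff `F` on length-`N` paths, for
the binomial model `{an, ap}` with `an < 0 < ap`: the expectation of `F` under the i.i.d.
product measure in which each coordinate equals `an` with probability `ap / (ap - an)` and
equals `ap` with probability `-an / (ap - an)`. -/
noncomputable def binPriceList (N : ℕ) (an ap : ℝ) (F : List ℝ → ℝ) : ℝ :=
  ∑ ε : Fin N → Bool,
    (∏ i, (if ε i then -an else ap) / (ap - an)) *
      F (List.ofFn fun i => if ε i then ap else an)

theorem binPriceList_zero (an ap : ℝ) (F : List ℝ → ℝ) : binPriceList 0 an ap F = F [] := by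
  simp [binPriceList]

theorem binPriceList_succ (N : ℕ) (an ap : ℝ) (F : List ℝ → ℝ) :
    binPriceList (N + 1) an ap F =
      -an / (ap - an) * binPriceList N an ap (fun ξ => F (ap :: ξ)) +
        ap / (ap - an) * binPriceList N an ap (fun ξ => F (an :: ξ)) := by
  unfold binPriceList
  rw [← (Fin.consEquiv fun _ : Fin (N + 1) => Bool).sum_comp, Fintype.sum_prod_type]
  simp [-Finset.prod_div_distrib, Fin.consEquiv, Fin.prod_univ_succ, List.ofFn_succ,
    Finset.mul_sum, mul_assoc]

theorem binPriceList_neg (N : ℕ) (an ap : ℝ) (F : List ℝ → ℝ) :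
    binPriceList N an ap (fun ξ => -F ξ) = -binPriceList N an ap F := by
  simp [binPriceList]

/-- The binomial price is at most any initial capital that superhedges on `{an, ap}`-paths. -/
theorem binPriceList_le_of_superhedge {an ap : ℝ} (han : an < 0) (hap : 0 < ap)
    (P : List ℝ → ℝ) (N : ℕ) (F : List ℝ → ℝ) (pre : List ℝ) (α : ℝ)
    (h : ∀ ξ : List ℝ, ξ.length = N → (∀ x ∈ ξ, x = an ∨ x = ap) →
      F ξ ≤ α + capitalAux P pre ξ) :
    binPriceList N an ap F ≤ α := by
  induction N generalizing F pre α with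
  | zero => simpa [binPriceList_zero, capitalAux] using h [] rfl (by simp)
  | succ N ih =>
    have step (x : ℝ) (hx : x = an ∨ x = ap) :
        binPriceList N an ap (fun ξ => F (x :: ξ)) ≤ α + P pre * x := by
      refine ih _ (pre ++ [x]) _ fun ξ hl hξ => ?_
      have := h (x :: ξ) (by simp [hl]) (by simpa [hx] using hξ)
      rw [capitalAux] at this
      linarith
    have hd : 0 < ap - an := by linarith
    rw [binPriceList_succ]
    calc _ ≤ -an / (ap - an) * (α + P pre * ap) + ap / (ap - an) * (α + P pre * an) :=
          add_le_add
            (mul_le_mul_of_nonneg_left (step ap (.inr rfl))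
              (div_nonneg (by linarith) hd.le))
            (mul_le_mul_of_nonneg_left (step an (.inl rfl)) (div_nonneg hap.le hd.le))
      _ = α := by
          field_simp
          ring

theorem exists_upper_bound_on_paths (X : Finset ℝ) (N : ℕ) (F : List ℝ → ℝ) :
    ∃ C : ℝ, ∀ ξ : List ℝ, ξ.length = N → (∀ x ∈ ξ, x ∈ X) → F ξ ≤ C := by
  induction N generalizing F with
  | zero => exact ⟨F [], fun ξ hl _ => by rw [List.length_eq_zero_iff.mp hl]⟩
  | succ N ih =>
    choose C hC using fun x : ℝ => ih fun ξ => F (x :: ξ)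
    refine ⟨∑ x ∈ X, |C x|, fun ξ hl hξ => ?_⟩
    match ξ with
    | [] => simp at hl
    | x :: ξ =>
      rw [List.forall_mem_cons] at hξ
      calc F (x :: ξ) ≤ C x := hC x ξ (by simpa using hl) hξ.2
        _ ≤ |C x| := le_abs_self _
        _ ≤ ∑ x ∈ X, |C x| :=
          Finset.single_le_sum (f := fun x => |C x|) (fun _ _ => abs_nonneg _) hξ.1

theorem capitalAux_zero (pre ξ : List ℝ) : capitalAux (fun _ => 0) pre ξ = 0 := by
  induction ξ generalizing pre with
  | nil => rfl
  | cons x ξ ih => simp [capitalAux, ih]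

theorem binPriceList_le_upperPrice (X : Finset ℝ) (N : ℕ) (F : List ℝ → ℝ) {an ap : ℝ}
    (han : an ∈ X) (hap : ap ∈ X) (hanneg : an < 0) (happos : 0 < ap) :
    binPriceList N an ap F ≤ upperPrice X N F := by
  refine le_csInf ?_ ?_
  · obtain ⟨C, hC⟩ := exists_upper_bound_on_paths X N F
    exact ⟨C, fun _ => 0, fun ξ hl hξ => by simpa [capitalAux_zero] using hC ξ hl hξ⟩
  · rintro α ⟨P, hP⟩
    refine binPriceList_le_of_superhedge hanneg happos P N F [] α fun ξ hl hξ => hP ξ hl ?_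
    intro x hx
    rcases hξ x hx with rfl | rfl <;> assumption

/-- Every binomial price obtained from a pair `an < 0 < ap` of elements of `X` lies
between the lower and the upper hedging prices of the `N`-round game on `X`. -/
theorem binomial_price_between (X : Finset ℝ)
    (hneg : ∃ a ∈ X, a < 0) (hpos : ∃ a ∈ X, 0 < a)
    (N : ℕ) (F : List ℝ → ℝ)
    (an ap : ℝ) (han : an ∈ X) (hap : ap ∈ X) (hanneg : an < 0) (happos : 0 < ap) :
    lowerPrice X N F ≤ binPriceList N an ap F ∧ binPriceList N an ap F ≤ upperPrice X N F := by
  refine ⟨?_, binPriceList_le_upperPrice X N F han hap hanneg happos⟩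
  have h := binPriceList_le_upperPrice X N (fun ξ => -F ξ) han hap hanneg happos
  rw [binPriceList_neg] at h
  exact neg_le.mp h
end
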